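/- Let w₁,…,w_N ∈ ℝⁿ and α ≥ √2 · max_i ‖w_i‖₂. Let K = (1/α) ∩_{i=1}^N {x : |⟨x, w_i⟩| ≤ α}. Then the Gaussian measure satisfies γₙ(αK) ≥ exp(-2 ∑_{i=1}^N exp(-α²/(2‖w_i‖₂²))). -/

import Mathlib

open MeasureTheory ProbabilityTheory Real Pointwise

lemma bm_compact {K L C : Set ℝ} (hK : IsCompact K) (hL : IsCompact L) (hK0 : K.Nonempty)
    (hL0 : L.Nonempty) (h : ∀ x ∈ K, ∀ y ∈ L, x + y ∈ C) :
    volume K + volume L ≤ volume C := by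
  obtain ⟨p, hp, hpm⟩ := hK.exists_isGreatest hK0
  obtain ⟨q, hq, hqm⟩ := hL.exists_isLeast hL0
  have h1 : volume ((fun x => q + x) '' K) = volume K := by
    simp
  have h2 : volume ((fun x => p + x) '' L) = volume L := by
    simp
  have hd : AEDisjoint volume ((fun x => q + x) '' K) ((fun x => p + x) '' L) := by
    refine measure_mono_null (t := {p + q}) ?_ (by simp)
    rintro z ⟨⟨x, hx, rfl⟩, ⟨y, hy, hxy⟩⟩
    have e1 := hpm hx
    have e2 := hqm hy
    simp only at hxy
    simp only [Set.mem_singleton_iff]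
    linarith
  rw [← h1, ← h2, ← measure_union₀ _ hd]
  · apply measure_mono
    rintro z (⟨x, hx, rfl⟩ | ⟨y, hy, rfl⟩)
    · simpa [add_comm] using h x hx q hq
    · exact h p hp y hy
  · exact (hL.image (by fun_prop)).measurableSet.nullMeasurableSet

lemma exists_cpt {A : Set ℝ} (hA : MeasurableSet A) (h0 : A.Nonempty) {r : ENNReal}
    (hr : r < volume A ∨ r = 0) : ∃ K ⊆ A, IsCompact K ∧ K.Nonempty ∧ r ≤ volume K := by
  rcases hr with hr | rfl
  · obtain ⟨K, hKA, hK, hr⟩ := hA.exists_lt_isCompact hr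
    refine ⟨K, hKA, hK, ?_, hr.le⟩
    by_contra hne
    rw [Set.not_nonempty_iff_eq_empty] at hne
    simp [hne] at hr
  · obtain ⟨x, hx⟩ := h0
    exact ⟨{x}, by simpa using hx, isCompact_singleton, by simp, by simp⟩

lemma bm_add {A B C : Set ℝ} (hA : MeasurableSet A) (hB : MeasurableSet B) (hA0 : A.Nonempty)
    (hB0 : B.Nonempty) (h : ∀ x ∈ A, ∀ y ∈ B, x + y ∈ C) :
    volume A + volume B ≤ volume C := by
  have key : ∀ r s : ENNReal, (r < volume A ∨ r = 0) → (s < volume B ∨ s = 0) →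
      r + s ≤ volume C := by
    intro r s hr hs
    obtain ⟨K, hKA, hK, hK0, hrK⟩ := exists_cpt hA hA0 hr
    obtain ⟨L, hLB, hL, hL0, hsL⟩ := exists_cpt hB hB0 hs
    exact (add_le_add hrK hsL).trans
      (bm_compact hK hL hK0 hL0 fun x hx y hy => h x (hKA hx) y (hLB hy))
  have key2 : ∀ s : ENNReal, (s < volume B ∨ s = 0) → volume A + s ≤ volume C := by
    intro s hs
    rcases eq_or_ne (volume A) 0 with h0 | h0
    · rw [h0]; exact key 0 s (Or.inr rfl) hs
    · have : (nhdsWithin (volume A) (Set.Iio (volume A))).NeBot :=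
        nhdsLT_neBot_of_exists_lt ⟨0, pos_iff_ne_zero.2 h0⟩
      have ht : Filter.Tendsto (fun r : ENNReal => r + s)
          (nhdsWithin (volume A) (Set.Iio (volume A))) (nhds (volume A + s)) :=
        ((continuous_id.add continuous_const).tendsto (volume A)).mono_left nhdsWithin_le_nhds
      refine le_of_tendsto ht ?_
      filter_upwards [self_mem_nhdsWithin] with r hr
      exact key r s (Or.inl hr) hs
  rcases eq_or_ne (volume B) 0 with h0 | h0
  · rw [h0]; exact key2 0 (Or.inr rfl)
  · have : (nhdsWithin (volume B) (Set.Iio (volume B))).NeBot :=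
      nhdsLT_neBot_of_exists_lt ⟨0, pos_iff_ne_zero.2 h0⟩
    have ht : Filter.Tendsto (fun r : ENNReal => volume A + r)
        (nhdsWithin (volume B) (Set.Iio (volume B))) (nhds (volume A + volume B)) :=
      ((continuous_const.add continuous_id).tendsto (volume B)).mono_left nhdsWithin_le_nhds
    refine le_of_tendsto ht ?_
    filter_upwards [self_mem_nhdsWithin] with r hr
    exact key2 r (Or.inl hr)

lemma bm_scaled {A B C : Set ℝ} (hA : MeasurableSet A) (hB : MeasurableSet B) (hA0 : A.Nonempty)
    (hB0 : B.Nonempty) {a : ℝ} (ha : 0 < a) (ha1 : a < 1)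
    (h : ∀ x ∈ A, ∀ y ∈ B, a * x + (1 - a) * y ∈ C) :
    ENNReal.ofReal a * volume A + ENNReal.ofReal (1 - a) * volume B ≤ volume C := by
  have h1 : volume (a • A) = ENNReal.ofReal a * volume A := by
    rw [Measure.addHaar_smul]; simp [abs_of_pos ha]
  have h2 : volume ((1 - a) • B) = ENNReal.ofReal (1 - a) * volume B := by
    rw [Measure.addHaar_smul]; simp [abs_of_pos (sub_pos.2 ha1)]
  rw [← h1, ← h2]
  refine bm_add (hA.const_smul₀ a) (hB.const_smul₀ _) (hA0.smul_set) (hB0.smul_set) ?_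
  rintro _ ⟨x, hx, rfl⟩ _ ⟨y, hy, rfl⟩
  exact h x hx y hy

/-- normalized version -/
lemma pl_norm {f g h : ℝ → ℝ} (hf : Measurable f) (hg : Measurable g) (hh : Measurable h)
    (hf0 : ∀ x, 0 ≤ f x) (hg0 : ∀ x, 0 ≤ g x) (hh0 : ∀ x, 0 ≤ h x)
    (hfi : Integrable f) (hgi : Integrable g) (hhi : Integrable h)
    (hf1 : ∀ x, f x ≤ 1) (hg1 : ∀ x, g x ≤ 1)
    (hfs : ∀ s < 1, ∃ x, s < f x) (hgs : ∀ s < 1, ∃ x, s < g x)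
    {a : ℝ} (ha : 0 < a) (ha1 : a < 1)
    (H : ∀ x y, f x ^ a * g y ^ (1 - a) ≤ h (a * x + (1 - a) * y)) :
    a * (∫ x, f x) + (1 - a) * ∫ x, g x ≤ ∫ x, h x := by
  have lf := lintegral_eq_lintegral_meas_lt volume (Filter.Eventually.of_forall hf0) hf.aemeasurable
  have lg := lintegral_eq_lintegral_meas_lt volume (Filter.Eventually.of_forall hg0) hg.aemeasurable
  have lh := lintegral_eq_lintegral_meas_lt volume (Filter.Eventually.of_forall hh0) hh.aemeasurable
  have mf : Measurable fun s : ℝ => volume {x | s < f x} :=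
    Antitone.measurable fun s t hst => measure_mono fun x hx => lt_of_le_of_lt hst hx
  have mg : Measurable fun s : ℝ => volume {x | s < g x} :=
    Antitone.measurable fun s t hst => measure_mono fun x hx => lt_of_le_of_lt hst hx
  have key : ENNReal.ofReal a * (∫⁻ x, ENNReal.ofReal (f x)) +
      ENNReal.ofReal (1 - a) * (∫⁻ x, ENNReal.ofReal (g x)) ≤ ∫⁻ x, ENNReal.ofReal (h x) := by
    rw [lf, lg, lh, ← lintegral_const_mul _ mf, ← lintegral_const_mul _ mg,
      ← lintegral_add_left (mf.const_mul _)]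
    refine setLIntegral_mono' measurableSet_Ioi fun s hs => ?_
    have hs : 0 < s := hs
    rcases lt_or_ge s 1 with h1 | h1
    · refine bm_scaled (measurableSet_lt measurable_const hf)
        (measurableSet_lt measurable_const hg) (hfs s h1) (hgs s h1) ha ha1 ?_
      intro x hx y hy
      have hx : s < f x := hx
      have hy : s < g y := hy
      refine lt_of_lt_of_le ?_ (H x y)
      calc s = s ^ a * s ^ (1 - a) := by rw [← rpow_add hs]; simp
        _ < f x ^ a * g y ^ (1 - a) := by
          apply mul_lt_mul'' (rpow_lt_rpow hs.le hx ha) (rpow_lt_rpow hs.le hy (by linarith))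
            <;> positivity
    · have e1 : {x | s < f x} = ∅ := by
        ext x; simp only [Set.mem_ofPred_eq, Set.mem_empty_iff_false, iff_false, not_lt]
        exact (hf1 x).trans h1
      have e2 : {x | s < g x} = ∅ := by
        ext x; simp only [Set.mem_ofPred_eq, Set.mem_empty_iff_false, iff_false, not_lt]
        exact (hg1 x).trans h1
      simp [e1, e2]
  rw [← ofReal_integral_eq_lintegral_ofReal hfi (Filter.Eventually.of_forall hf0),
    ← ofReal_integral_eq_lintegral_ofReal hgi (Filter.Eventually.of_forall hg0),
    ← ofReal_integral_eq_lintegral_ofReal hhi (Filter.Eventually.of_forall hh0),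
    ← ENNReal.ofReal_mul ha.le, ← ENNReal.ofReal_mul (by linarith),
    ← ENNReal.ofReal_add (mul_nonneg ha.le (integral_nonneg hf0))
      (mul_nonneg (by linarith) (integral_nonneg hg0))] at key
  exact (ENNReal.ofReal_le_ofReal_iff (integral_nonneg hh0)).1 key

lemma exists_sup {f : ℝ → ℝ} (hf0 : ∀ x, 0 ≤ f x) {c : ℝ} (hfc : ∀ x, f x ≤ c)
    (hne : ∫ x, f x ≠ 0) : ∃ M, 0 < M ∧ (∀ x, f x / M ≤ 1) ∧ ∀ s < 1, ∃ x, s < f x / M := by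
  have hb : BddAbove (Set.range f) := ⟨c, by rintro _ ⟨x, rfl⟩; exact hfc x⟩
  have hM : 0 < ⨆ x, f x := by
    by_contra hcon
    apply hne
    have : ∀ x, f x = 0 := fun x => le_antisymm ((le_ciSup hb x).trans (not_lt.1 hcon)) (hf0 x)
    simp [this]
  refine ⟨⨆ x, f x, hM, fun x => ?_, fun s hs => ?_⟩
  · rw [div_le_one hM]; exact le_ciSup hb x
  · obtain ⟨x, hx⟩ := exists_lt_of_lt_ciSup (f := f) (show s * (⨆ x, f x) < ⨆ x, f x by nlinarith)
    exact ⟨x, by rwa [lt_div_iff₀ hM]⟩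

/-- Prekopa-Leindler in dimension one. -/
lemma pl_one {f g h : ℝ → ℝ} (hf : Measurable f) (hg : Measurable g) (hh : Measurable h)
    (hf0 : ∀ x, 0 ≤ f x) (hg0 : ∀ x, 0 ≤ g x) (hh0 : ∀ x, 0 ≤ h x)
    (hfi : Integrable f) (hgi : Integrable g) (hhi : Integrable h) {c : ℝ}
    (hf1 : ∀ x, f x ≤ c) (hg1 : ∀ x, g x ≤ c)
    {a : ℝ} (ha : 0 < a) (ha1 : a < 1)
    (H : ∀ x y, f x ^ a * g y ^ (1 - a) ≤ h (a * x + (1 - a) * y)) :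
    (∫ x, f x) ^ a * (∫ x, g x) ^ (1 - a) ≤ ∫ x, h x := by
  have ha' : 0 < 1 - a := by linarith
  by_cases h1 : ∫ x, f x = 0
  · rw [h1, zero_rpow ha.ne', zero_mul]; exact integral_nonneg hh0
  by_cases h2 : ∫ x, g x = 0
  · rw [h2, zero_rpow ha'.ne', mul_zero]; exact integral_nonneg hh0
  obtain ⟨M, hM, hM1, hMs⟩ := exists_sup hf0 hf1 h1
  obtain ⟨N, hN, hN1, hNs⟩ := exists_sup hg0 hg1 h2
  have hMN : 0 < M ^ a * N ^ (1 - a) := by positivity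
  have key := pl_norm (f := fun x => f x / M) (g := fun x => g x / N)
    (h := fun x => h x / (M ^ a * N ^ (1 - a))) (hf.div_const _) (hg.div_const _) (hh.div_const _)
    (fun x => div_nonneg (hf0 x) hM.le) (fun x => div_nonneg (hg0 x) hN.le)
    (fun x => div_nonneg (hh0 x) hMN.le) (hfi.div_const _) (hgi.div_const _) (hhi.div_const _)
    hM1 hN1 hMs hNs ha ha1 (by
      intro x y
      rw [div_rpow (hf0 x) hM.le, div_rpow (hg0 y) hN.le, div_mul_div_comm]
      exact div_le_div_of_nonneg_right (H x y) hMN.le)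
  rw [integral_div, integral_div, integral_div] at key
  have amgm := geom_mean_le_arith_mean2_weighted (p₁ := (∫ x, f x) / M)
    (p₂ := (∫ x, g x) / N) ha.le ha'.le
    (div_nonneg (integral_nonneg hf0) hM.le) (div_nonneg (integral_nonneg hg0) hN.le) (by ring)
  have := amgm.trans key
  rw [div_rpow (integral_nonneg hf0) hM.le, div_rpow (integral_nonneg hg0) hN.le,
    div_mul_div_comm] at this
  exact (div_le_div_iff_of_pos_right hMN).1 this

/-- log-concavity, multiplicative form -/
def LC {E : Type*} [AddCommGroup E] [Module ℝ E] (F : E → ℝ) : Prop :=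
  ∀ x y : E, ∀ a : ℝ, 0 < a → a < 1 → F x ^ a * F y ^ (1 - a) ≤ F (a • x + (1 - a) • y)

lemma phi_lc : LC (gaussianPDFReal 0 1) := by
  intro x y a ha ha1
  simp only [gaussianPDFReal, NNReal.coe_one, mul_one, sub_zero, smul_eq_mul]
  have hc : 0 < (√(2 * π))⁻¹ := by positivity
  rw [mul_rpow hc.le (exp_pos _).le, mul_rpow hc.le (exp_pos _).le, mul_mul_mul_comm,
    ← rpow_add hc, ← exp_mul, ← exp_mul, ← exp_add]
  simp only [add_sub_cancel, rpow_one]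
  gcongr
  nlinarith [mul_nonneg (mul_nonneg ha.le (sub_nonneg.2 ha1.le)) (sq_nonneg (x - y))]

lemma phi_le : ∀ x, gaussianPDFReal 0 1 x ≤ (√(2 * π))⁻¹ := by
  intro x
  simp only [gaussianPDFReal, NNReal.coe_one, mul_one, sub_zero]
  have hc : 0 < (√(2 * π))⁻¹ := by positivity
  have : exp (-x ^ 2 / 2) ≤ 1 := exp_le_one_iff.2 (by nlinarith [sq_nonneg x])
  nlinarith

lemma lc_step {E : Type*} [AddCommGroup E] [Module ℝ E] [MeasurableSpace E] {F : E × ℝ → ℝ}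
    (hF : Measurable F) (h0 : ∀ p, 0 ≤ F p) (h1 : ∀ p, F p ≤ 1) (hLC : LC F) :
    LC (fun x => ∫ t, F (x, t) ∂gaussianReal 0 1) := by
  intro x y a ha ha1
  simp only
  rw [integral_gaussianReal_eq_integral_smul one_ne_zero,
    integral_gaussianReal_eq_integral_smul one_ne_zero,
    integral_gaussianReal_eq_integral_smul one_ne_zero]
  simp only [smul_eq_mul]
  have hm : ∀ z : E, Measurable fun t => gaussianPDFReal 0 1 t * F (z, t) := fun z =>
    (measurable_gaussianPDFReal 0 1).mul (hF.comp measurable_prodMk_left)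
  have hp : ∀ t, 0 ≤ gaussianPDFReal 0 1 t := gaussianPDFReal_nonneg 0 1
  have hn : ∀ z : E, ∀ t, 0 ≤ gaussianPDFReal 0 1 t * F (z, t) := fun z t =>
    mul_nonneg (hp t) (h0 _)
  have hi : ∀ z : E, Integrable fun t => gaussianPDFReal 0 1 t * F (z, t) := fun z => by
    refine (integrable_gaussianPDFReal 0 1).mono' (hm z).aestronglyMeasurable
      (Filter.Eventually.of_forall fun t => ?_)
    rw [Real.norm_of_nonneg (hn z t)]
    exact mul_le_of_le_one_right (hp t) (h1 _)
  have hb : ∀ z : E, ∀ t, gaussianPDFReal 0 1 t * F (z, t) ≤ (√(2 * π))⁻¹ := fun z t =>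
    (mul_le_of_le_one_right (hp t) (h1 _)).trans (phi_le t)
  refine pl_one (hm x) (hm y) (hm _) (hn x) (hn y) (hn _) (hi x) (hi y) (hi _) (hb x) (hb y)
    ha ha1 ?_
  intro s t
  rw [mul_rpow (hp s) (h0 _), mul_rpow (hp t) (h0 _), mul_mul_mul_comm]
  exact mul_le_mul (phi_lc s t a ha ha1) (hLC (x, s) (y, t) a ha ha1)
    (mul_nonneg (rpow_nonneg (h0 _) _) (rpow_nonneg (h0 _) _)) (hp _)

lemma lc_pi {E : Type*} [AddCommGroup E] [Module ℝ E] [MeasurableSpace E] (n : ℕ) :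
    ∀ {F : E × (Fin n → ℝ) → ℝ}, Measurable F → (∀ p, 0 ≤ F p) → (∀ p, F p ≤ 1) → LC F →
    LC (fun x => ∫ t, F (x, t) ∂(Measure.pi fun _ : Fin n => gaussianReal 0 1)) := by
  induction n with
  | zero =>
    intro F hF h0 h1 hLC x y a ha ha1
    simp only [Measure.pi_of_empty (fun _ : Fin 0 => gaussianReal 0 1) default, integral_dirac]
    refine (hLC (x, default) (y, default) a ha ha1).trans (le_of_eq ?_)
    congr 1
    exact Prod.ext rfl (Subsingleton.elim _ _)
  | succ n ih =>
    intro F hF h0 h1 hLC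
    let G : (E × (Fin n → ℝ)) × ℝ → ℝ := fun p => F (p.1.1, Fin.cons p.2 p.1.2)
    have hmc : Measurable fun p : (E × (Fin n → ℝ)) × ℝ =>
        (p.1.1, (Fin.cons p.2 p.1.2 : Fin (n + 1) → ℝ)) := by
      refine Measurable.prodMk (by fun_prop) (measurable_pi_iff.2 fun i => ?_)
      refine Fin.cases ?_ (fun j => ?_) i
      · simp only [Fin.cons_zero]; fun_prop
      · simp only [Fin.cons_succ]; fun_prop
    have hG : Measurable G := hF.comp hmc
    have hGLC : LC G := by
      intro p q a ha ha1
      refine (hLC _ _ a ha ha1).trans (le_of_eq ?_)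
      simp only [G]
      congr 1
      refine Prod.ext rfl ?_
      funext i
      refine Fin.cases ?_ (fun j => ?_) i <;> simp
    have hs := lc_step hG (fun _ => h0 _) (fun _ => h1 _) hGLC
    have hmG : Measurable fun p : E × (Fin n → ℝ) => ∫ t, G (p, t) ∂gaussianReal 0 1 :=
      (hG.stronglyMeasurable.integral_prod_right' (ν := gaussianReal 0 1)).measurable
    have hiG : ∀ p, Integrable (fun t => G (p, t)) (gaussianReal 0 1) := fun p =>
      Integrable.of_bound (hG.comp measurable_prodMk_left).aestronglyMeasurable 1
        (Filter.Eventually.of_forall fun t => by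
          rw [Real.norm_of_nonneg (h0 _)]; exact h1 _)
    have := ih hmG (fun p => integral_nonneg fun t => h0 _)
      (fun p => by
        refine (integral_mono (hiG p) (integrable_const 1) fun t => h1 _).trans ?_
        simp) hs
    convert this using 2 with x
    have hmp := (measurePreserving_piFinSuccAbove
      (fun _ : Fin (n + 1) => gaussianReal 0 1) 0).symm
    rw [← hmp.integral_comp']
    rw [integral_prod_symm]
    · have e : ∀ (t : ℝ) (z : Fin n → ℝ),
          (MeasurableEquiv.piFinSuccAbove (fun _ : Fin (n + 1) => ℝ) 0).symm (t, z)
            = (Fin.cons t z : Fin (n + 1) → ℝ) := fun t z => Fin.insertNth_zero' t z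
      simp only [e, G]
    · refine Integrable.of_bound (Measurable.aestronglyMeasurable ?_) 1
        (Filter.Eventually.of_forall fun t => by
          rw [Real.norm_of_nonneg (h0 _)]; exact h1 _)
      exact hF.comp (measurable_prodMk_left.comp (MeasurableEquiv.measurable _))

lemma exp_one (d : ℝ) : ∫ t, Complex.exp (((t * d : ℝ) : ℂ) * Complex.I) ∂gaussianReal 0 1
    = Complex.exp (((-d ^ 2 / 2 : ℝ) : ℂ)) := by
  have := charFun_gaussianReal (μ := 0) (v := 1) d
  rw [charFun_apply_real] at this
  convert this using 2
  · ext t; congr 1; push_cast; ring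
  · push_cast; ring

lemma exp_pi {n : ℕ} (c : Fin n → ℝ) :
    ∫ x, Complex.exp (((∑ j, x j * c j : ℝ) : ℂ) * Complex.I)
      ∂(Measure.pi fun _ : Fin n => gaussianReal 0 1)
    = Complex.exp (((-(∑ j, c j ^ 2) / 2 : ℝ) : ℂ)) := by
  simp_rw [Complex.ofReal_sum, Finset.sum_mul, Complex.exp_sum]
  rw [integral_fintype_prod_eq_prod
    (f := fun (i : Fin n) (x : ℝ) => Complex.exp (((x * c i : ℝ) : ℂ) * Complex.I))]
  simp_rw [exp_one]
  rw [← Complex.exp_sum]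
  congr 1
  push_cast
  rw [← Finset.sum_neg_distrib, Finset.sum_div]

def splitMap {n : ℕ} (u : Fin n → ℝ) (p : ℝ × (Fin n → ℝ)) : Fin n → ℝ :=
  fun j => p.1 * u j + (p.2 j - (∑ k, p.2 k * u k) * u j)

lemma splitMap_measurable {n : ℕ} (u : Fin n → ℝ) : Measurable (splitMap u) := by
  unfold splitMap; fun_prop

lemma splitMap_sum {n : ℕ} (u : Fin n → ℝ) (c : Fin n → ℝ) (p : ℝ × (Fin n → ℝ)) :
    ∑ j, splitMap u p j * c j = p.1 * (∑ j, u j * c j) +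
      ∑ j, p.2 j * (c j - (∑ j, u j * c j) * u j) := by
  simp only [splitMap]
  set d := ∑ j, u j * c j with hd
  set e := ∑ k, p.2 k * u k with he
  have h1 : ∑ j, p.2 j * (c j - d * u j) = ∑ j, p.2 j * c j - d * e := by
    rw [he, Finset.mul_sum, ← Finset.sum_sub_distrib]
    exact Finset.sum_congr rfl fun j _ => by ring
  have h2 : ∑ j, (p.1 * u j + (p.2 j - e * u j)) * c j
      = p.1 * d + (∑ j, p.2 j * c j - e * d) := by
    rw [hd, Finset.mul_sum, Finset.mul_sum, ← Finset.sum_sub_distrib, ← Finset.sum_add_distrib]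
    exact Finset.sum_congr rfl fun j _ => by ring
  rw [h1, h2]; ring

lemma splitMap_map {n : ℕ} (u : Fin n → ℝ) (hu : ∑ j, u j ^ 2 = 1) :
    ((gaussianReal 0 1).prod (Measure.pi fun _ : Fin n => gaussianReal 0 1)).map (splitMap u)
      = Measure.pi fun _ : Fin n => gaussianReal 0 1 := by
  have : IsProbabilityMeasure (((gaussianReal 0 1).prod
      (Measure.pi fun _ : Fin n => gaussianReal 0 1)).map (splitMap u)) :=
    Measure.isProbabilityMeasure_map (splitMap_measurable u).aemeasurable
  apply Measure.ext_of_charFunDual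
  ext L
  obtain ⟨c, hc⟩ : ∃ c : Fin n → ℝ, ∀ x, L x = ∑ j, x j * c j := by
    refine ⟨fun j => L (Pi.single j 1), fun x => ?_⟩
    conv_lhs => rw [pi_eq_sum_univ' x]
    rw [map_sum]
    refine Finset.sum_congr rfl fun j _ => ?_
    rw [map_smul, smul_eq_mul]
  rw [charFunDual_apply, charFunDual_apply, integral_map (splitMap_measurable u).aemeasurable
    (by fun_prop)]
  simp_rw [hc, splitMap_sum]
  rw [exp_pi]
  simp_rw [Complex.ofReal_add, add_mul, Complex.exp_add]
  rw [integral_prod_mul (fun t : ℝ => Complex.exp (((t * (∑ j, u j * c j) : ℝ) : ℂ) * Complex.I))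
    (fun x : Fin n → ℝ => Complex.exp
      (((∑ j, x j * (c j - (∑ j, u j * c j) * u j) : ℝ) : ℂ) * Complex.I)),
    exp_one, exp_pi, ← Complex.exp_add, ← Complex.ofReal_add]
  congr 2
  set d := ∑ j, u j * c j with hd
  have h1 : ∑ j, (c j - d * u j) ^ 2 = ∑ j, c j ^ 2 - d ^ 2 := by
    have gen : ∀ e : ℝ, ∑ j, (c j - e * u j) ^ 2 = ∑ j, c j ^ 2 - 2 * e * ∑ j, u j * c j
        + e ^ 2 * ∑ j, u j ^ 2 := by
      intro e
      rw [Finset.mul_sum, Finset.mul_sum, ← Finset.sum_sub_distrib, ← Finset.sum_add_distrib]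
      exact Finset.sum_congr rfl fun j _ => by ring
    rw [gen d, hu, ← hd]; ring
  rw [h1]; ring

lemma gauss_neg_inv : (gaussianReal 0 1).IsNegInvariant :=
  ⟨by have := gaussianReal_map_neg (μ := 0) (v := 1); simpa [Measure.neg] using this⟩

lemma tail_Ioi {b : ℝ} (hb : 0 < b) :
    (gaussianReal 0 1).real (Set.Ioi b) ≤ (√(2 * π))⁻¹ * exp (-b ^ 2 / 2) / b := by
  have hc : 0 < (√(2 * π))⁻¹ := by positivity
  have hd : ∀ x ∈ Set.Ici b, HasDerivAt (fun t => -((√(2 * π))⁻¹ * exp (-t ^ 2 / 2) / b))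
      (x / b * ((√(2 * π))⁻¹ * exp (-x ^ 2 / 2))) x := by
    intro x _
    have h1 : HasDerivAt (fun t : ℝ => -t ^ 2 / 2) (-x) x := by
      have := ((hasDerivAt_pow 2 x).fun_neg).div_const 2
      exact this.congr_deriv (by push_cast; ring)
    have := (((h1.exp).const_mul (√(2 * π))⁻¹).div_const b).fun_neg
    exact this.congr_deriv (by ring)
  have hpos : ∀ x ∈ Set.Ioi b, 0 ≤ x / b * ((√(2 * π))⁻¹ * exp (-x ^ 2 / 2)) := by
    intro x hx
    have : 0 < x := hb.trans hx
    positivity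
  have ht : Filter.Tendsto (fun t => -((√(2 * π))⁻¹ * exp (-t ^ 2 / 2) / b)) Filter.atTop
      (nhds 0) := by
    have h1 : Filter.Tendsto (fun t : ℝ => -t ^ 2 / 2) Filter.atTop Filter.atBot := by
      have := (Filter.tendsto_pow_atTop (α := ℝ) two_ne_zero).atTop_div_const (r := 2) (by norm_num)
      refine (Filter.tendsto_neg_atTop_atBot.comp this).congr fun t => ?_
      simp [neg_div]
    have := (((tendsto_exp_atBot.comp h1).const_mul (√(2 * π))⁻¹).div_const b).neg
    simpa using this
  have hI := integral_Ioi_of_hasDerivAt_of_nonneg' hd hpos ht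
  have hint := integrableOn_Ioi_deriv_of_nonneg' hd hpos ht
  have e1 : (gaussianReal 0 1).real (Set.Ioi b) = ∫ x in Set.Ioi b, gaussianPDFReal 0 1 x := by
    rw [measureReal_def, gaussianReal_apply_eq_integral 0 one_ne_zero, ENNReal.toReal_ofReal]
    exact integral_nonneg fun x => gaussianPDFReal_nonneg 0 1 x
  rw [e1]
  calc _ ≤ ∫ x in Set.Ioi b, x / b * ((√(2 * π))⁻¹ * exp (-x ^ 2 / 2)) := by
        refine setIntegral_mono_on (integrable_gaussianPDFReal 0 1).integrableOn hint
          measurableSet_Ioi fun x hx => ?_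
        have hx : b < x := hx
        simp only [gaussianPDFReal, NNReal.coe_one, mul_one, sub_zero]
        have : 1 ≤ x / b := (one_le_div hb).2 hx.le
        exact le_mul_of_one_le_left (by positivity) this
    _ = _ := by rw [hI]; ring

lemma slab_one {b : ℝ} (hb : 1 ≤ b) :
    1 - exp (-b ^ 2 / 2) ≤ (gaussianReal 0 1).real (Set.Icc (-b) b) := by
  have hb0 : 0 < b := by linarith
  have := gauss_neg_inv
  have h1 := tail_Ioi hb0
  have h2 : (gaussianReal 0 1).real (Set.Iio (-b)) = (gaussianReal 0 1).real (Set.Ioi b) := by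
    rw [measureReal_def, measureReal_def, ← Measure.measure_neg]
    simp
  have h3 : (Set.Icc (-b) b)ᶜ = Set.Iio (-b) ∪ Set.Ioi b := by
    ext x; simp only [Set.mem_compl_iff, Set.mem_Icc, not_and_or, not_le, Set.mem_union,
      Set.mem_Iio, Set.mem_Ioi]
  have h4 := probReal_compl_eq_one_sub (μ := gaussianReal 0 1) (measurableSet_Icc (a := -b) (b := b))
  rw [h3] at h4
  have h5 := measureReal_union_le (μ := gaussianReal 0 1) (Set.Iio (-b)) (Set.Ioi b)
  have h6 : (√(2 * π))⁻¹ * exp (-b ^ 2 / 2) / b ≤ exp (-b ^ 2 / 2) / 2 := by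
    have hs : 2 ≤ √(2 * π) := by
      apply Real.le_sqrt_of_sq_le; nlinarith [pi_gt_three]
    have hs' : (√(2 * π))⁻¹ ≤ 1 / 2 := by
      rw [← one_div]; exact one_div_le_one_div_of_le (by norm_num) hs
    have he := exp_pos (-b ^ 2 / 2)
    rw [div_le_iff₀ hb0]
    nlinarith [mul_le_mul_of_nonneg_right hs' he.le]
  linarith

lemma lc_indicator {E : Type*} [AddCommGroup E] [Module ℝ E] {A : Set E} (hA : Convex ℝ A) :
    LC (A.indicator (fun _ => (1 : ℝ))) := by
  intro x y a ha ha1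
  by_cases hx : x ∈ A
  · by_cases hy : y ∈ A
    · have : a • x + (1 - a) • y ∈ A := hA hx hy ha.le (by linarith) (by ring)
      simp [hx, hy, this]
    · rw [Set.indicator_of_notMem hy, zero_rpow (by linarith), mul_zero]
      exact Set.indicator_nonneg (fun _ _ => zero_le_one) _
  · rw [Set.indicator_of_notMem hx, zero_rpow ha.ne', zero_mul]
    exact Set.indicator_nonneg (fun _ _ => zero_le_one) _

lemma lc_even_mono {f : ℝ → ℝ} (hLC : LC f) (h0 : ∀ t, 0 ≤ f t) (he : ∀ t, f (-t) = f t)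
    {s t : ℝ} (hst : |s| ≤ |t|) : f t ≤ f s := by
  have habs : ∀ r, f |r| = f r := fun r => by
    rcases abs_choice r with h | h <;> rw [h]
    exact he r
  rw [← habs t, ← habs s]
  rcases hst.eq_or_lt with h | h
  · rw [h]
  set p := |s| with hp
  set q := |t| with hq
  have hp0 : 0 ≤ p := abs_nonneg s
  have hq0 : 0 < q := lt_of_le_of_lt hp0 h
  have hr : p / q < 1 := (div_lt_one hq0).2 h
  have hr0 : 0 ≤ p / q := by positivity
  have := hLC q (-q) ((1 + p / q) / 2) (by linarith) (by linarith)
  rw [he q] at this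
  have e1 : f q ^ ((1 + p / q) / 2) * f q ^ (1 - (1 + p / q) / 2) = f q := by
    rw [← rpow_add_of_nonneg (h0 q) (by linarith) (by linarith)]
    simp
  have e2 : ((1 + p / q) / 2) • q + (1 - (1 + p / q) / 2) • (-q) = p := by
    simp only [smul_eq_mul]
    field_simp
    ring
  rwa [e1, e2] at this

lemma sidak_unit {n : ℕ} {A : Set (Fin n → ℝ)} (hAm : MeasurableSet A) (hA : Convex ℝ A)
    (hneg : ∀ x ∈ A, -x ∈ A) (u : Fin n → ℝ) (hu : ∑ j, u j ^ 2 = 1) {b : ℝ} (hb : 0 ≤ b) :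
    (Measure.pi fun _ : Fin n => gaussianReal 0 1).real A *
      (gaussianReal 0 1).real (Set.Icc (-b) b) ≤
    (Measure.pi fun _ : Fin n => gaussianReal 0 1).real (A ∩ {x | |∑ j, x j * u j| ≤ b}) := by
  set γ := Measure.pi fun _ : Fin n => gaussianReal 0 1 with hγ
  have hi1 := gauss_neg_inv
  have hi2 : γ.IsNegInvariant := by rw [hγ]; infer_instance
  set F : ℝ × (Fin n → ℝ) → ℝ := fun p => A.indicator (fun _ => (1 : ℝ)) (splitMap u p) with hF
  have hind : Measurable (A.indicator (fun _ => (1 : ℝ))) := measurable_const.indicator hAm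
  have hFm : Measurable F := hind.comp (splitMap_measurable u)
  have hF0 : ∀ p, 0 ≤ F p := fun p => Set.indicator_nonneg (fun _ _ => zero_le_one) _
  have hF1 : ∀ p, F p ≤ 1 := fun p => Set.indicator_le_self' (fun _ _ => zero_le_one) _
  have hlin : ∀ (p q : ℝ × (Fin n → ℝ)) (a c : ℝ),
      splitMap u (a • p + c • q) = a • splitMap u p + c • splitMap u q := by
    intro p q a c
    funext j
    simp only [splitMap, Prod.fst_add, Prod.snd_add, Prod.smul_fst, Prod.smul_snd, Pi.add_apply,
      Pi.smul_apply, smul_eq_mul]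
    have : ∑ k, (a * p.2 k + c * q.2 k) * u k
        = a * ∑ k, p.2 k * u k + c * ∑ k, q.2 k * u k := by
      rw [Finset.mul_sum, Finset.mul_sum, ← Finset.sum_add_distrib]
      exact Finset.sum_congr rfl fun k _ => by ring
    rw [this]; ring
  have hFLC : LC F := by
    intro p q a ha ha1
    refine (lc_indicator hA _ _ a ha ha1).trans (le_of_eq ?_)
    simp only [hF, hlin]
  have hFneg : ∀ p, F (-p) = F p := by
    intro p
    have e : splitMap u (-p) = - splitMap u p := by
      have := hlin p 0 (-1) 0
      simpa using this
    have hiff : - splitMap u p ∈ A ↔ splitMap u p ∈ A :=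
      ⟨fun h => by simpa using hneg _ h, hneg _⟩
    change A.indicator (fun _ => (1 : ℝ)) (splitMap u (-p)) = A.indicator _ (splitMap u p)
    rw [e]
    by_cases h : splitMap u p ∈ A
    · rw [Set.indicator_of_mem h, Set.indicator_of_mem (hiff.2 h)]
    · rw [Set.indicator_of_notMem h, Set.indicator_of_notMem fun h' => h (hiff.1 h')]
  set f : ℝ → ℝ := fun t => ∫ x, F (t, x) ∂γ with hf
  have hfLC : LC f := lc_pi n hFm hF0 hF1 hFLC
  have hf0 : ∀ t, 0 ≤ f t := fun t => integral_nonneg fun x => hF0 _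
  have hfe : ∀ t, f (-t) = f t := by
    intro t
    simp only [hf]
    rw [← integral_neg_eq_self]
    exact integral_congr_ae (Filter.Eventually.of_forall fun x => hFneg (t, x))
  have hFi : Integrable F ((gaussianReal 0 1).prod γ) :=
    Integrable.of_bound hFm.aestronglyMeasurable 1
      (Filter.Eventually.of_forall fun t => by rw [Real.norm_of_nonneg (hF0 _)]; exact hF1 _)
  have hfi : Integrable f (gaussianReal 0 1) := hFi.integral_prod_left
  set P : ℝ → ℝ := (Set.Icc (-b) b).indicator (fun _ => (1 : ℝ)) with hP
  have hPm : Measurable P := measurable_const.indicator measurableSet_Icc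
  have hPi : Integrable P (gaussianReal 0 1) :=
    (integrable_const (1 : ℝ)).indicator measurableSet_Icc
  have hfP : Integrable (fun t => f t * P t) (gaussianReal 0 1) := by
    have := hfi.indicator (measurableSet_Icc (a := -b) (b := b))
    refine this.congr (Filter.Eventually.of_forall fun t => ?_)
    by_cases ht : t ∈ Set.Icc (-b) b <;> simp only [hP, ht, Set.indicator_of_mem,
      Set.indicator_of_notMem, not_false_eq_true, mul_one, mul_zero]
  have hmp : MeasurePreserving (splitMap u) ((gaussianReal 0 1).prod γ) γ :=
    ⟨splitMap_measurable u, splitMap_map u hu⟩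
  have eA : γ.real A = ∫ t, f t ∂gaussianReal 0 1 := by
    rw [← integral_indicator_one hAm]
    conv_lhs => rw [← hmp.map_eq]
    rw [integral_map hmp.measurable.aemeasurable
      (measurable_one.indicator hAm).aestronglyMeasurable]
    exact integral_prod F hFi
  have hS : MeasurableSet {x : Fin n → ℝ | |∑ j, x j * u j| ≤ b} :=
    measurableSet_le (by fun_prop) measurable_const
  have hsu : ∀ p, ∑ j, splitMap u p j * u j = p.1 := by
    intro p
    rw [splitMap_sum]
    have : ∑ j, u j * u j = 1 := by rw [← hu]; exact Finset.sum_congr rfl fun j _ => by ring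
    simp [this]
  have eAP : γ.real (A ∩ {x | |∑ j, x j * u j| ≤ b}) = ∫ t, f t * P t ∂gaussianReal 0 1 := by
    have e : ∀ p : ℝ × (Fin n → ℝ),
        (A ∩ {x | |∑ j, x j * u j| ≤ b}).indicator (1 : (Fin n → ℝ) → ℝ) (splitMap u p)
          = F p * P p.1 := by
      intro p
      have hm : splitMap u p ∈ {x : Fin n → ℝ | |∑ j, x j * u j| ≤ b} ↔ p.1 ∈ Set.Icc (-b) b := by
        rw [Set.mem_ofPred_eq, hsu, abs_le, Set.mem_Icc]
      by_cases h1 : splitMap u p ∈ A <;> by_cases h2 : p.1 ∈ Set.Icc (-b) b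
      · rw [Set.indicator_of_mem (Set.mem_inter h1 (hm.2 h2))]
        simp only [hF, hP, Set.indicator_of_mem h1, Set.indicator_of_mem h2]; simp
      · rw [Set.indicator_of_notMem fun h => h2 (hm.1 h.2)]
        simp only [hP, Set.indicator_of_notMem h2, mul_zero]
      · rw [Set.indicator_of_notMem fun h => h1 h.1]
        simp only [hF, Set.indicator_of_notMem h1, zero_mul]
      · rw [Set.indicator_of_notMem fun h => h1 h.1]
        simp only [hF, Set.indicator_of_notMem h1, zero_mul]
    rw [← integral_indicator_one (hAm.inter hS)]
    conv_lhs => rw [← hmp.map_eq]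
    rw [integral_map hmp.measurable.aemeasurable
      (measurable_one.indicator (hAm.inter hS)).aestronglyMeasurable]
    simp_rw [e]
    rw [integral_prod]
    · simp only [integral_mul_const, hf]
    · refine Integrable.of_bound
        (hFm.mul (hPm.comp measurable_fst)).aestronglyMeasurable 1
        (Filter.Eventually.of_forall fun p => ?_)
      have hp0 : 0 ≤ P p.1 := Set.indicator_nonneg (fun _ _ => zero_le_one) _
      have hp1 : P p.1 ≤ 1 := Set.indicator_le_self' (fun _ _ => zero_le_one) _
      rw [Real.norm_of_nonneg (mul_nonneg (hF0 _) hp0)]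
      exact mul_le_one₀ (hF1 _) hp0 hp1
  set m := (gaussianReal 0 1).real (Set.Icc (-b) b) with hm
  have hm1 : m ≤ 1 := measureReal_le_one
  have hm0 : 0 ≤ m := measureReal_nonneg
  have eP : ∫ t, P t ∂gaussianReal 0 1 = m := integral_indicator_one measurableSet_Icc
  have hpt : ∀ t, f t * m + f b * (P t - m) ≤ f t * P t := by
    intro t
    by_cases ht : t ∈ Set.Icc (-b) b
    · have hp : P t = 1 := Set.indicator_of_mem ht _
      have : f b ≤ f t := lc_even_mono hfLC hf0 hfe (by
        rw [abs_of_nonneg hb]; exact abs_le.2 ht)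
      rw [hp]; nlinarith
    · have hp : P t = 0 := Set.indicator_of_notMem ht _
      have : f t ≤ f b := lc_even_mono hfLC hf0 hfe (by
        rw [abs_of_nonneg hb]
        by_contra hcon
        exact ht (abs_le.1 (not_le.1 hcon).le))
      rw [hp]; nlinarith
  have hPm' : Integrable (fun t => P t - m) (gaussianReal 0 1) := hPi.sub (integrable_const m)
  have := integral_mono ((hfi.mul_const m).add (hPm'.const_mul (f b))) hfP hpt
  rw [integral_add' (hfi.mul_const m) (hPm'.const_mul (f b)), integral_mul_const,
    integral_const_mul, integral_sub hPi (integrable_const m), eP] at this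
  rw [eA, eAP]
  simpa using this

lemma one_sub_ge {x : ℝ} (h0 : 0 ≤ x) (h1 : x ≤ 1 / 2) : exp (-2 * x) ≤ 1 - x := by
  have h2 : 1 + 2 * x ≤ exp (2 * x) := by linarith [add_one_le_exp (2 * x)]
  have h3 : exp (-2 * x) * exp (2 * x) = 1 := by rw [← exp_add]; simp
  have h4 := exp_pos (-2 * x)
  nlinarith

lemma sidak_step {n : ℕ} {A : Set (Fin n → ℝ)} (hAm : MeasurableSet A) (hA : Convex ℝ A)
    (hneg : ∀ x ∈ A, -x ∈ A) (w : Fin n → ℝ) {α : ℝ} (hα0 : 0 < α)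
    (hα : √2 * √(∑ j, (w j) ^ 2) ≤ α) :
    (Measure.pi fun _ : Fin n => gaussianReal 0 1).real A *
      exp (-2 * exp (-α ^ 2 / (2 * ∑ j, (w j) ^ 2))) ≤
    (Measure.pi fun _ : Fin n => gaussianReal 0 1).real (A ∩ {x | |∑ j, x j * w j| ≤ α}) := by
  have hs0 : 0 ≤ ∑ j, (w j) ^ 2 := Finset.sum_nonneg fun j _ => sq_nonneg _
  rcases hs0.eq_or_lt with h | h
  · have hw : ∀ j, w j = 0 := by
      intro j
      have := (Finset.sum_eq_zero_iff_of_nonneg (fun j _ => sq_nonneg (w j))).1 h.symm j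
        (Finset.mem_univ j)
      simpa using this
    have : {x : Fin n → ℝ | |∑ j, x j * w j| ≤ α} = Set.univ := by
      ext x; simp [hw, hα0.le]
    rw [this, Set.inter_univ]
    refine mul_le_of_le_one_right measureReal_nonneg (exp_le_one_iff.2 ?_)
    nlinarith [exp_pos (-α ^ 2 / (2 * ∑ j, (w j) ^ 2))]
  · set r := √(∑ j, (w j) ^ 2) with hr
    have hr0 : 0 < r := sqrt_pos.2 h
    have hr2 : r ^ 2 = ∑ j, (w j) ^ 2 := sq_sqrt hs0
    set b := α / r with hb
    have hb2 : √2 ≤ b := (le_div_iff₀ hr0).2 hα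
    have hb0 : 0 ≤ b := (sqrt_nonneg 2).trans hb2
    have hbb : 2 ≤ b ^ 2 := by
      have := pow_le_pow_left₀ (sqrt_nonneg 2) hb2 2
      rwa [sq_sqrt (by norm_num)] at this
    have hb1 : 1 ≤ b := by nlinarith
    have key := sidak_unit hAm hA hneg (fun j => w j / r) (by
      simp_rw [div_pow]
      rw [← Finset.sum_div, ← hr2, div_self (by positivity)]) hb0
    have eset : {x : Fin n → ℝ | |∑ j, x j * (w j / r)| ≤ b}
        = {x | |∑ j, x j * w j| ≤ α} := by
      ext x
      have : ∑ j, x j * (w j / r) = (∑ j, x j * w j) / r := by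
        rw [Finset.sum_div]; exact Finset.sum_congr rfl fun j _ => by ring
      rw [Set.mem_ofPred_eq, Set.mem_ofPred_eq, this, abs_div, abs_of_pos hr0, hb,
        div_le_div_iff_of_pos_right hr0]
    rw [eset] at key
    refine le_trans (mul_le_mul_of_nonneg_left ?_ measureReal_nonneg) key
    have ee : -α ^ 2 / (2 * ∑ j, (w j) ^ 2) = -b ^ 2 / 2 := by
      rw [← hr2, hb]; field_simp
    rw [ee]
    refine le_trans (one_sub_ge (exp_pos _).le ?_) (slab_one hb1)
    have h1 : exp (-b ^ 2 / 2) ≤ exp (-1) := exp_le_exp.2 (by linarith)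
    have h2 : exp (-1) * exp 1 = 1 := by rw [← exp_add]; simp
    have h3 : (2 : ℝ) ≤ exp 1 := by linarith [add_one_le_exp (1 : ℝ)]
    nlinarith [exp_pos (-1 : ℝ)]

lemma slab_conv {n : ℕ} (w : Fin n → ℝ) (α : ℝ) :
    Convex ℝ {x : Fin n → ℝ | |∑ j, x j * w j| ≤ α} := by
  intro x hx y hy a c ha hc hac
  have hx : |∑ j, x j * w j| ≤ α := hx
  have hy : |∑ j, y j * w j| ≤ α := hy
  change |∑ j, (a • x + c • y) j * w j| ≤ α
  have : ∑ j, (a • x + c • y) j * w j = a * ∑ j, x j * w j + c * ∑ j, y j * w j := by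
    rw [Finset.mul_sum, Finset.mul_sum, ← Finset.sum_add_distrib]
    exact Finset.sum_congr rfl fun k _ => by
      simp only [Pi.add_apply, Pi.smul_apply, smul_eq_mul]; ring
  rw [this]
  rw [abs_le] at *
  have : c = 1 - a := by linarith
  subst this
  constructor <;> nlinarith [mul_le_mul_of_nonneg_left hx.1 ha, mul_le_mul_of_nonneg_left hx.2 ha,
    mul_le_mul_of_nonneg_left hy.1 hc, mul_le_mul_of_nonneg_left hy.2 hc]

lemma sidak_all {n N : ℕ} (w : Fin N → (Fin n → ℝ)) {α : ℝ} (hα0 : 0 < α)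
    (hα : ∀ i, √2 * √(∑ j, (w i j) ^ 2) ≤ α) (s : Finset (Fin N)) :
    exp (-2 * ∑ i ∈ s, exp (-α ^ 2 / (2 * ∑ j, (w i j) ^ 2))) ≤
    (Measure.pi fun _ : Fin n => gaussianReal 0 1).real
      (⋂ i ∈ s, {x | |∑ j, x j * w i j| ≤ α}) := by
  classical
  induction s using Finset.induction_on with
  | empty => simp
  | insert i s hi ih =>
    rw [Finset.sum_insert hi, Finset.set_biInter_insert, Set.inter_comm, mul_add, exp_add, mul_comm]
    refine le_trans (mul_le_mul_of_nonneg_right ih (exp_pos _).le) ?_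
    refine sidak_step ?_ ?_ ?_ (w i) hα0 (hα i)
    · exact Finset.measurableSet_biInter _ fun i _ =>
        measurableSet_le (by fun_prop) measurable_const
    · exact convex_iInter₂ fun i _ => slab_conv (w i) α
    · intro x hx
      simp only [Set.mem_iInter, Set.mem_ofPred_eq] at hx ⊢
      intro k hk
      have := hx k hk
      simpa [Finset.sum_neg_distrib, abs_neg] using this

theorem gaussian_measure_slab_intersection (n N : ℕ) (hn : 0 < n) (hN : 0 < N)
    (w : Fin N → (Fin n → ℝ)) (α : ℝ)
    (hα : ∀ i, Real.sqrt 2 * Real.sqrt (∑ j, (w i j) ^ 2) ≤ α) (hα0 : 0 < α)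
    (K : Set (Fin n → ℝ))
    (hK : K = α⁻¹ • ⋂ i : Fin N, {x : Fin n → ℝ | |∑ j, x j * w i j| ≤ α}) :
    ENNReal.ofReal
        (Real.exp (-2 * ∑ i : Fin N, Real.exp (-α ^ 2 / (2 * ∑ j, (w i j) ^ 2)))) ≤
      (Measure.pi fun _ : Fin n => gaussianReal 0 1) (α • K) := by
  rw [hK, smul_inv_smul₀ hα0.ne']
  have := sidak_all w hα0 hα Finset.univ
  simp only [Finset.mem_univ, Set.iInter_true] at this
  exact ENNReal.ofReal_le_of_le_toReal this
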